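/- arXiv:0805.4682 — 3 statements merged into one kernel-verified Lean document; each statement's English description precedes it below -/
import Mathlib

section
/- For all fixed integers k, m ≥ 1 and every ε > 0 there exists a constant C ≥ 0 (depending only on k, m, ε) such that for all real h ≥ 1: |Σ* S(h)^m − μ_k(m) · h*_k| ≤ C · h^{k − 1/2 + ε}, where Σ* runs over all k-tuples h of distinct positive integers with h_i ≤ h, and h*_k denotes the number of such k-tuples. -/
open Filter Topology

noncomputable def nup {k : ℕ} (h : Fin k → ℕ) (p : ℕ) : ℕ :=
  (Set.range fun i => ((h i : ZMod p))).ncard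

/-- The `p`-factor `(1 - ν_p(h)/p) * (1 - 1/p)^(-k)` of the singular series. -/
noncomputable def singFactor {k : ℕ} (h : Fin k → ℕ) (p : ℕ) : ℝ :=
  (1 - (nup h p : ℝ) / p) * (1 - 1 / (p : ℝ)) ^ (-(k : ℤ))

/-- The singular series `S(h) = ∏_p (1 - ν_p(h)/p)(1 - 1/p)^(-k)`. -/
noncomputable def singSeries {k : ℕ} (h : Fin k → ℕ) : ℝ :=
  ∏' p : Nat.Primes, singFactor h (p : ℕ)

/-- The `k`-tuples of distinct positive integers with all entries `≤ H`. -/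
def distinctTuples (k H : ℕ) : Finset (Fin k → ℕ) :=
  (Fintype.piFinset fun _ : Fin k => Finset.Icc 1 H).filter Function.Injective

/-- `p^(-k) * Σ_{u ∈ (ℤ/p)^k} (1 - ρ_p(u)/p)^m`, where `ρ_p(u)` is the number of
distinct components of `u`. -/
noncomputable def halfTerm (k m : ℕ) (p : Nat.Primes) : ℝ :=
  haveI : NeZero (p : ℕ) := ⟨p.2.ne_zero⟩
  ((p : ℕ) : ℝ) ^ (-(k : ℤ)) *
    ∑ u : Fin k → ZMod (p : ℕ), (1 - ((Set.range u).ncard : ℝ) / ((p : ℕ) : ℝ)) ^ m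

/-- The `p`-factor `(1 - 1/p)^(-km) * (p^(-k) Σ_u (1 - ρ_p(u)/p)^m)` of `μ_k(m)`. -/
noncomputable def muFactor (k m : ℕ) (p : Nat.Primes) : ℝ :=
  (1 - 1 / ((p : ℕ) : ℝ)) ^ (-((k * m : ℕ) : ℤ)) * halfTerm k m p

/-- `μ_k(m)`, the Euler product over all primes. -/
noncomputable def muMoment (k m : ℕ) : ℝ :=
  ∏' p : Nat.Primes, muFactor k m p

lemma summable_and_tsum_finset_prod_le {ι : Type*} {f : ι → ℝ} {M : ℝ} (hf : ∀ i, 0 ≤ f i)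
    (h : ∀ F : Finset ι, ∏ i ∈ F, (1 + f i) ≤ M) :
    Summable (fun T : Finset ι ↦ ∏ i ∈ T, f i) ∧ ∑' T : Finset ι, ∏ i ∈ T, f i ≤ M := by
  classical
  have h0 : (0 : Finset ι → ℝ) ≤ fun T ↦ ∏ i ∈ T, f i :=
    fun T ↦ Finset.prod_nonneg fun i _ ↦ hf i
  have hle : ∀ U : Finset (Finset ι), ∑ T ∈ U, ∏ i ∈ T, f i ≤ M := fun U ↦
    calc ∑ T ∈ U, ∏ i ∈ T, f i
        ≤ ∑ T ∈ (U.biUnion id).powerset, ∏ i ∈ T, f i :=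
          Finset.sum_le_sum_of_subset_of_nonneg
            (fun T hT ↦ Finset.mem_powerset.2 (Finset.subset_biUnion_of_mem id hT))
            fun T _ _ ↦ h0 T
      _ = ∏ i ∈ U.biUnion id, (1 + f i) := (Finset.prod_one_add _).symm
      _ ≤ M := h _
  exact ⟨summable_of_sum_le h0 hle, Real.tsum_le_of_sum_le h0 hle⟩

lemma abs_tsum_sub_sum_le {α : Type*} {g v : α → ℝ} {c : ℝ} (s : Finset α)
    (hg : Summable g) (hv : Summable v) (hv0 : ∀ x, 0 ≤ v x) (hc : 0 ≤ c)
    (h : ∀ x ∉ s, |g x| ≤ c * v x) :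
    |∑' x, g x - ∑ x ∈ s, g x| ≤ c * ∑' x, v x := by
  rw [← hg.sum_add_tsum_subtype_compl s, add_sub_cancel_left, ← tsum_mul_left]
  have hcv : Summable fun x ↦ c * v x := hv.mul_left c
  have hcv' : Summable fun x : {x // x ∉ s} ↦ c * v x := hcv.subtype _
  calc |∑' x : {x // x ∉ s}, g x| ≤ ∑' x : {x // x ∉ s}, c * v x :=
        tsum_of_norm_bounded (f := fun x : {x // x ∉ s} ↦ g x) hcv'.hasSum
          fun x ↦ h x x.2
    _ ≤ ∑' x, c * v x :=
        hcv.tsum_subtype_le _ {x | x ∉ s} fun x ↦ mul_nonneg hc (hv0 x)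

lemma exists_pow_card_primeFactors_le {A δ : ℝ} (hA : 1 ≤ A) (hδ : 0 < δ) :
    ∃ K : ℝ, 0 ≤ K ∧ ∀ n : ℕ, n ≠ 0 → A ^ n.primeFactors.card ≤ K * (n : ℝ) ^ δ := by
  obtain ⟨P, hP⟩ := exists_nat_ge (A ^ (1 / δ))
  have hA0 : 0 < A := by linarith
  refine ⟨A ^ P, by positivity, fun n hn ↦ ?_⟩
  have hone : ∀ p ∈ n.primeFactors, (1 : ℝ) ≤ p := fun p hp ↦ by
    exact_mod_cast (Nat.prime_of_mem_primeFactors hp).one_le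
  calc A ^ n.primeFactors.card = ∏ p ∈ n.primeFactors, A := by simp
    _ ≤ ∏ p ∈ n.primeFactors, ((if p < P then A else 1) * (p : ℝ) ^ δ) := by
        refine Finset.prod_le_prod (fun _ _ ↦ hA0.le) fun p hp ↦ ?_
        have h1 : 1 ≤ (p : ℝ) ^ δ := Real.one_le_rpow (hone p hp) hδ.le
        split_ifs with hpP
        · nlinarith
        · have h2 : A ^ (1 / δ) ≤ p := hP.trans (by exact_mod_cast not_lt.1 hpP)
          have h3 := Real.rpow_le_rpow (by positivity) h2 hδ.le
          rw [← Real.rpow_mul hA0.le, one_div_mul_cancel hδ.ne', Real.rpow_one] at h3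
          linarith
    _ = A ^ (n.primeFactors.filter (· < P)).card * ((∏ p ∈ n.primeFactors, p : ℕ) : ℝ) ^ δ := by
        rw [Finset.prod_mul_distrib, Finset.prod_ite]
        simp only [Finset.prod_const, one_pow, mul_one]
        push_cast
        rw [Real.finsetProd_rpow _ _ fun p _ ↦ Nat.cast_nonneg p]
    _ ≤ A ^ P * (n : ℝ) ^ δ := by
        gcongr
        · calc (n.primeFactors.filter (· < P)).card ≤ (Finset.range P).card :=
                Finset.card_le_card fun p hp ↦ by simp at hp ⊢; exact hp.2
            _ = P := Finset.card_range P
        · exact Nat.le_of_dvd (Nat.pos_of_ne_zero hn) (Nat.prod_primeFactors_dvd n)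

lemma one_sub_pow_le {x : ℝ} (h0 : 0 ≤ x) (h1 : x ≤ 1) (k : ℕ) :
    (1 - x) ^ k ≤ 1 - k * x + k ^ 2 * x ^ 2 := by
  induction k with
  | zero => simp
  | succ k ih =>
    rw [pow_succ]
    have hk : (0 : ℝ) ≤ k := k.cast_nonneg
    have h2 : (0 : ℝ) ≤ k ^ 2 * x ^ 3 := by positivity
    have h3 : (0 : ℝ) ≤ k * x ^ 2 := by positivity
    push_cast
    nlinarith [mul_le_mul_of_nonneg_right ih (sub_nonneg.2 h1), sq_nonneg x]

/-- Deviation from `1` of the `m`-th power of an Euler factor. -/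
lemma exists_abs_factor_pow_sub_one_le (k m : ℕ) :
    ∃ A : ℝ, 0 ≤ A ∧ ∀ p ν : ℕ, 2 ≤ p → ν ≤ k →
      |((1 - (ν : ℝ) / p) * (1 - 1 / (p : ℝ)) ^ (-(k : ℤ))) ^ m - 1| ≤
        A * (1 / (p : ℝ) ^ 2 + if ν = k then 0 else 1 / (p : ℝ)) := by
  refine ⟨2 ^ k * (2 * k + k ^ 2) * m * (2 ^ k * (k + 1)) ^ (m - 1), by positivity,
    fun p ν hp hν ↦ ?_⟩
  have hp' : (2 : ℝ) ≤ p := by exact_mod_cast hp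
  set x : ℝ := 1 / p with hx
  have hx0 : 0 ≤ x := by positivity
  have hx2 : x ≤ 1 / 2 := by rw [hx]; gcongr
  have hνx : (ν : ℝ) / p = ν * x := by rw [hx]; ring
  have hνk : (ν : ℝ) ≤ k := by exact_mod_cast hν
  have hxx : 1 / (p : ℝ) ^ 2 = x ^ 2 := by rw [hx]; ring
  rw [hνx, hxx, zpow_neg, zpow_natCast]
  set q : ℝ := ((1 - x) ^ k)⁻¹ with hq
  have hpos : 0 < (1 - x) ^ k := by apply pow_pos; linarith
  have hq0 : 0 < q := by positivity
  have hq2 : q ≤ 2 ^ k := by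
    rw [hq, ← inv_pow]
    gcongr
    · apply inv_nonneg.2; linarith
    · rw [inv_le_comm₀ (by linarith) (by norm_num)]; linarith
  have hk0 : (0 : ℝ) ≤ k := k.cast_nonneg
  have hν0 : (0 : ℝ) ≤ ν := ν.cast_nonneg
  have hs : |(1 - ν * x) * q| ≤ 2 ^ k * (k + 1) := by
    rw [abs_mul, abs_of_pos hq0, mul_comm]
    gcongr
    rw [abs_le]
    constructor <;> nlinarith
  have hlow : 1 - k * x ≤ (1 - x) ^ k := by
    have := one_add_mul_le_pow (a := -x) (by linarith) k
    rw [← sub_eq_add_neg] at this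
    linarith
  have hup1 : (1 - x) ^ k ≤ 1 := pow_le_one₀ (by linarith) (by linarith)
  have hup := one_sub_pow_le hx0 (by linarith) k
  have hkey : |(1 - ν * x) - (1 - x) ^ k| ≤
      (2 * k + k ^ 2) * (x ^ 2 + if ν = k then 0 else x) := by
    split_ifs with h
    · subst h
      rw [abs_le]
      constructor <;> nlinarith [mul_nonneg hν0 (sq_nonneg x)]
    · have h1 : (ν : ℝ) * x ≤ k * x := by gcongr
      have h2 : 0 ≤ (ν : ℝ) * x := by positivity
      have h3 : (0 : ℝ) ≤ k ^ 2 * x := by positivity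
      have h4 : (0 : ℝ) ≤ (2 * k + k ^ 2) * x ^ 2 := by positivity
      have h5 : (0 : ℝ) ≤ k * x := by positivity
      rw [abs_le]
      constructor <;> nlinarith
  have hdiff : |(1 - ν * x) * q - 1| ≤
      2 ^ k * ((2 * k + k ^ 2) * (x ^ 2 + if ν = k then 0 else x)) := by
    have : (1 - ν * x) * q - 1 = q * ((1 - ν * x) - (1 - x) ^ k) := by
      rw [mul_sub, hq, inv_mul_cancel₀ hpos.ne']; ring
    rw [this, abs_mul, abs_of_pos hq0]
    gcongr
  have hone : (1 : ℝ) ≤ 2 ^ k * (k + 1) :=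
    one_le_mul_of_one_le_of_one_le (one_le_pow₀ one_le_two) (by linarith)
  have hmain := abs_pow_sub_pow_le ((1 - ν * x) * q) 1 m
  rw [one_pow, abs_one] at hmain
  calc _ ≤ _ := hmain
    _ ≤ 2 ^ k * ((2 * k + k ^ 2) * (x ^ 2 + if ν = k then 0 else x)) * m *
          (2 ^ k * (k + 1)) ^ (m - 1) := by
        gcongr
        exact max_le hs hone
    _ = _ := by ring

lemma card_filter_not_injective_le {α : Type*} [DecidableEq α] (S : Finset α) (k : ℕ) :
    ((Fintype.piFinset fun _ : Fin k ↦ S).filter fun t ↦ ¬ Function.Injective t).card ≤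
      k ^ 2 * S.card ^ (k - 1) := by
  cases k with
  | zero => simp [Function.injective_of_subsingleton]
  | succ n =>
  have hsub : ((Fintype.piFinset fun _ : Fin (n + 1) ↦ S).filter fun t ↦ ¬ Function.Injective t) ⊆
      (Finset.univ : Finset (Fin (n + 1) × Fin (n + 1))).biUnion fun ij ↦
        (Fintype.piFinset fun _ : Fin (n + 1) ↦ S).filter fun t ↦
          ij.1 ≠ ij.2 ∧ t ij.1 = t ij.2 := by
    intro t ht
    rw [Finset.mem_filter, Function.Injective] at ht
    obtain ⟨ht, hinj⟩ := ht
    push Not at hinj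
    obtain ⟨i, j, hij, hne⟩ := hinj
    exact Finset.mem_biUnion.2 ⟨(i, j), Finset.mem_univ _, Finset.mem_filter.2 ⟨ht, hne, hij⟩⟩
  refine (Finset.card_le_card hsub).trans ((Finset.card_biUnion_le_card_mul _ _
    (S.card ^ n) fun ⟨i, j⟩ _ ↦ ?_).trans_eq ?_)
  · simp [sq]
  · rw [show S.card ^ n = (Fintype.piFinset fun _ : Fin n ↦ S).card by simp]
    refine Finset.card_le_card_of_injOn (fun t ↦ i.removeNth t) (fun t ht ↦ ?_) ?_
    · simp only [Finset.coe_filter, Fintype.mem_piFinset, Set.mem_ofPred_eq] at ht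
      simp only [Finset.mem_coe, Fintype.mem_piFinset]
      exact fun l ↦ ht.1 _
    · intro s hs t ht hst
      simp only [Finset.coe_filter, Fintype.mem_piFinset, Set.mem_ofPred_eq] at hs ht
      have hrem : ∀ l, l ≠ i → s l = t l := fun l hl ↦ by
        obtain ⟨l', rfl⟩ := Fin.exists_succAbove_eq hl
        exact congrFun hst l'
      funext l
      by_cases hl : l = i
      · rw [hl, hs.2.2, ht.2.2]
        exact hrem j hs.2.1.symm
      · exact hrem l hl

/-- `f t` depends only on the residues of the entries of `t` modulo `n`. -/
def ResiduePeriodic {k : ℕ} (n : ℕ) (f : (Fin k → ℕ) → ℝ) : Prop :=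
  ∀ s t : Fin k → ℕ, (∀ i, (s i : ZMod n) = t i) → f s = f t

/-- The mean of `f` over the block `{0, …, n - 1}^k`. -/
noncomputable def blockMean {k : ℕ} (n : ℕ) (f : (Fin k → ℕ) → ℝ) : ℝ :=
  (∑ t ∈ Fintype.piFinset fun _ : Fin k ↦ Finset.range n, f t) / (n : ℝ) ^ k

namespace ResiduePeriodic

variable {k n N : ℕ} {f : (Fin k → ℕ) → ℝ}

lemma of_dvd (hf : ResiduePeriodic n f) (h : n ∣ N) : ResiduePeriodic N f := by
  intro s t hst
  refine hf s t fun i ↦ ?_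
  have := congrArg (ZMod.castHom h (ZMod n)) (hst i)
  simpa only [map_natCast] using this

lemma prod {ι : Type*} {T : Finset ι} {f : ι → (Fin k → ℕ) → ℝ}
    (hf : ∀ i ∈ T, ResiduePeriodic n (f i)) : ResiduePeriodic n fun t ↦ ∏ i ∈ T, f i t :=
  fun s t hst ↦ Finset.prod_congr rfl fun i hi ↦ hf i hi s t hst

lemma abs (hf : ResiduePeriodic n f) : ResiduePeriodic n fun t ↦ |f t| :=
  fun s t hst ↦ congrArg _ (hf s t hst)

end ResiduePeriodic

section BlockMean

variable {k : ℕ}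

lemma sum_piFinset_range (n : ℕ) [NeZero n] (f : (Fin k → ℕ) → ℝ) :
    ∑ t ∈ Fintype.piFinset fun _ : Fin k ↦ Finset.range n, f t =
      ∑ u : Fin k → ZMod n, f fun i ↦ (u i).val := by
  refine Finset.sum_nbij' (fun t i ↦ (t i : ZMod n)) (fun u i ↦ (u i).val) ?_ ?_ ?_ ?_ ?_
  · simp
  · intro u _
    simpa using fun i ↦ ZMod.val_lt (u i)
  · intro t ht
    funext i
    exact ZMod.val_cast_of_lt (Finset.mem_range.1 (Fintype.mem_piFinset.1 ht i))
  · intro u _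
    funext i
    exact ZMod.natCast_zmod_val (u i)
  · intro t ht
    congr 1
    funext i
    exact (ZMod.val_cast_of_lt (Finset.mem_range.1 (Fintype.mem_piFinset.1 ht i))).symm

lemma blockMean_nonneg {n : ℕ} {f : (Fin k → ℕ) → ℝ} (hf : ∀ t, 0 ≤ f t) : 0 ≤ blockMean n f :=
  div_nonneg (Finset.sum_nonneg fun t _ ↦ hf t) (by positivity)

lemma abs_blockMean_le (n : ℕ) (f : (Fin k → ℕ) → ℝ) :
    |blockMean n f| ≤ blockMean n fun t ↦ |f t| := by
  rw [blockMean, blockMean, abs_div, abs_of_nonneg (by positivity : (0 : ℝ) ≤ (n : ℝ) ^ k)]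
  gcongr
  exact Finset.abs_sum_le_sum_abs _ _

lemma blockMean_mul_of_coprime {a b : ℕ} (ha : a ≠ 0) (hb : b ≠ 0) (hab : a.Coprime b)
    {f g : (Fin k → ℕ) → ℝ} (hf : ResiduePeriodic a f) (hg : ResiduePeriodic b g) :
    blockMean (a * b) (fun t ↦ f t * g t) = blockMean a f * blockMean b g := by
  have : NeZero a := ⟨ha⟩
  have : NeZero b := ⟨hb⟩
  have : NeZero (a * b) := ⟨mul_ne_zero ha hb⟩
  have key : ∑ u : Fin k → ZMod (a * b), (f fun i ↦ (u i).val) * (g fun i ↦ (u i).val) =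
      (∑ v : Fin k → ZMod a, f fun i ↦ (v i).val) * ∑ w : Fin k → ZMod b, g fun i ↦ (w i).val := by
    rw [Finset.sum_mul_sum, ← Fintype.sum_prod_type']
    refine Fintype.sum_equiv (((Equiv.refl (Fin k)).arrowCongr
      (ZMod.chineseRemainder hab).toEquiv).trans (Equiv.arrowProdEquivProdArrow _ _ _)) _ _
      fun u ↦ ?_
    have hcr : ∀ i, ZMod.chineseRemainder hab (u i) =
        (((u i).val : ZMod a), ((u i).val : ZMod b)) := fun i ↦ by
      conv_lhs => rw [← ZMod.natCast_zmod_val (u i), map_natCast]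
      rfl
    congr 1
    · refine hf _ _ fun i ↦ ?_
      change _ = ((ZMod.chineseRemainder hab (u i)).1.val : ZMod a)
      rw [ZMod.natCast_zmod_val, hcr]
    · refine hg _ _ fun i ↦ ?_
      change _ = ((ZMod.chineseRemainder hab (u i)).2.val : ZMod b)
      rw [ZMod.natCast_zmod_val, hcr]
  rw [blockMean, blockMean, blockMean, sum_piFinset_range, sum_piFinset_range, sum_piFinset_range,
    key, Nat.cast_mul, mul_pow, mul_div_mul_comm]

lemma blockMean_prod (T : Finset Nat.Primes) {f : Nat.Primes → (Fin k → ℕ) → ℝ}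
    (hf : ∀ p : Nat.Primes, ResiduePeriodic (p : ℕ) (f p)) :
    blockMean (∏ p ∈ T, (p : ℕ)) (fun t ↦ ∏ p ∈ T, f p t) = ∏ p ∈ T, blockMean (p : ℕ) (f p) := by
  classical
  induction T using Finset.induction_on with
  | empty => simp [blockMean]
  | insert p T hp ih =>
    simp only [Finset.prod_insert hp]
    rw [blockMean_mul_of_coprime p.2.ne_zero (Finset.prod_ne_zero_iff.2 fun (q : Nat.Primes) _ ↦ q.2.ne_zero)
      (Nat.Coprime.prod_right fun (q : Nat.Primes) hq ↦ (Nat.coprime_primes p.2 q.2).2 fun h ↦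
        hp (by rwa [Subtype.ext h])) (hf p)
      (ResiduePeriodic.prod fun q hq ↦ (hf q).of_dvd (Finset.dvd_prod_of_mem _ hq)), ih]

lemma abs_prod_sub_pow_le {k : ℕ} {x : Fin k → ℝ} {y B : ℝ} (hy : 0 ≤ y) (hyB : y ≤ B)
    (hx : ∀ i, |x i| ≤ B) (hxy : ∀ i, |x i - y| ≤ 1) :
    |∏ i, x i - y ^ k| ≤ k * B ^ (k - 1) := by
  induction k with
  | zero => simp
  | succ k ih =>
    have hB : 0 ≤ B := hy.trans hyB
    have hP : |∏ i : Fin k, x i.succ| ≤ B ^ k := by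
      rw [Finset.abs_prod]
      exact (Finset.prod_le_prod (fun _ _ ↦ abs_nonneg _) fun i _ ↦ hx _).trans_eq (by simp)
    have ih' := ih (x := fun i ↦ x i.succ) (fun i ↦ hx _) fun i ↦ hxy _
    have hk : B * (k * B ^ (k - 1)) = k * B ^ k := by
      cases k with
      | zero => simp
      | succ j => simp only [Nat.add_sub_cancel]; ring
    rw [Fin.prod_univ_succ, pow_succ', show x 0 * ∏ i : Fin k, x i.succ - y * y ^ k =
      (x 0 - y) * ∏ i : Fin k, x i.succ + y * (∏ i : Fin k, x i.succ - y ^ k) by ring]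
    calc _ ≤ |x 0 - y| * |∏ i : Fin k, x i.succ| + |y| * |∏ i : Fin k, x i.succ - y ^ k| := by
          rw [← abs_mul, ← abs_mul]; exact abs_add_le _ _
      _ ≤ 1 * B ^ k + B * (k * B ^ (k - 1)) := by
          rw [abs_of_nonneg hy]
          gcongr
          exact hxy 0
      _ = _ := by rw [hk, Nat.add_sub_cancel]; push_cast; ring

lemma abs_card_residue_sub_le {d H : ℕ} (hd : 0 < d) {r : ℕ} (hr : r < d) :
    |(((Finset.Icc 1 H).filter fun n ↦ n % d = r).card : ℝ) - (H : ℝ) / d| ≤ 1 := by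
  have hcard : (Finset.Icc 1 H).filter (fun n ↦ n % d = r) =
      (Finset.Ioc 0 H).filter fun n ↦ n ≡ r [MOD d] := by
    ext n
    simp [Nat.ModEq, Nat.mod_eq_of_lt hr, Nat.succ_le_iff]
  have h := Nat.Ioc_filter_modEq_card 0 H hd r
  rw [← hcard] at h
  have hmono : ⌊(((0 : ℕ) : ℚ) - r) / d⌋ ≤ ⌊((H : ℚ) - r) / d⌋ := by
    apply Int.floor_mono
    gcongr
    exact Nat.zero_le H
  rw [max_eq_left (by simpa using hmono)] at h
  have h1 := Int.floor_le (((H : ℚ) - r) / d)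
  have h2 := Int.lt_floor_add_one (((H : ℚ) - r) / d)
  have h3 := Int.floor_le ((((0 : ℕ) : ℚ) - r) / d)
  have h4 := Int.lt_floor_add_one ((((0 : ℕ) : ℚ) - r) / d)
  have h5 : ((H : ℚ) - r) / d - (((0 : ℕ) : ℚ) - r) / d = H / d := by push_cast; ring
  have hq : |(((Finset.Icc 1 H).filter fun n ↦ n % d = r).card : ℚ) - (H : ℚ) / d| ≤ 1 := by
    have h' : (((Finset.Icc 1 H).filter fun n ↦ n % d = r).card : ℚ) =
        (⌊((H : ℚ) - r) / d⌋ : ℚ) - ⌊(((0 : ℕ) : ℚ) - r) / d⌋ := by exact_mod_cast h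
    rw [h', abs_le]
    constructor <;> linarith
  have hr' := (Rat.cast_le (K := ℝ)).2 hq
  push_cast at hr'
  exact hr'

lemma abs_sum_box_sub_blockMean_le {d H : ℕ} (hd : 0 < d) (hdH : d ≤ H)
    {f : (Fin k → ℕ) → ℝ} (hf : ResiduePeriodic d f) :
    |∑ t ∈ Fintype.piFinset fun _ : Fin k ↦ Finset.Icc 1 H, f t - (H : ℝ) ^ k * blockMean d f| ≤
      k * 2 ^ (k - 1) * (H : ℝ) ^ (k - 1) * d * blockMean d fun t ↦ |f t| := by
  have hd' : (0 : ℝ) < d := by exact_mod_cast hd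
  have hH : (d : ℝ) ≤ H := by exact_mod_cast hdH
  set N : ℕ → ℕ := fun r ↦ ((Finset.Icc 1 H).filter fun n ↦ n % d = r).card with hN
  have hsum : ∑ t ∈ Fintype.piFinset fun _ : Fin k ↦ Finset.Icc 1 H, f t =
      ∑ v ∈ Fintype.piFinset fun _ : Fin k ↦ Finset.range d, f v * ∏ i, (N (v i) : ℝ) := by
    rw [← Finset.sum_fiberwise_of_maps_to (g := fun t i ↦ t i % d)
      (t := Fintype.piFinset fun _ : Fin k ↦ Finset.range d)
      (fun t _ ↦ by simpa using fun _ ↦ Nat.mod_lt _ hd)]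
    refine Finset.sum_congr rfl fun v _ ↦ ?_
    have hfib : (Fintype.piFinset fun _ : Fin k ↦ Finset.Icc 1 H).filter
        (fun t ↦ (fun i ↦ t i % d) = v) =
        Fintype.piFinset fun i ↦ (Finset.Icc 1 H).filter fun n ↦ n % d = v i := by
      ext t
      simp only [Finset.mem_filter, Fintype.mem_piFinset, funext_iff, forall_and]
    have hconst : ∀ t ∈ (Fintype.piFinset fun _ : Fin k ↦ Finset.Icc 1 H).filter
        (fun t ↦ (fun i ↦ t i % d) = v), f t = f v := fun t ht ↦ hf t v fun i ↦ by
      rw [← congrFun (Finset.mem_filter.1 ht).2 i, ZMod.natCast_mod]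
    rw [Finset.sum_congr rfl hconst, Finset.sum_const, hfib, Fintype.card_piFinset, nsmul_eq_mul,
      mul_comm, Nat.cast_prod]
  have hdiff : ∀ v ∈ Fintype.piFinset fun _ : Fin k ↦ Finset.range d,
      |∏ i, (N (v i) : ℝ) - ((H : ℝ) / d) ^ k| ≤ k * (2 * (H / d)) ^ (k - 1) := fun v hv ↦ by
    have h1 : ∀ i, |(N (v i) : ℝ) - (H : ℝ) / d| ≤ 1 := fun i ↦
      abs_card_residue_sub_le hd (Finset.mem_range.1 (Fintype.mem_piFinset.1 hv i))
    have h2 : 1 ≤ (H : ℝ) / d := (one_le_div hd').2 hH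
    refine abs_prod_sub_pow_le (by positivity) (by linarith) (fun i ↦ ?_) h1
    rw [Nat.abs_cast]
    linarith [(abs_le.1 (h1 i)).2]
  have hmain : ∑ t ∈ Fintype.piFinset fun _ : Fin k ↦ Finset.Icc 1 H, f t -
      (H : ℝ) ^ k * blockMean d f = ∑ v ∈ Fintype.piFinset fun _ : Fin k ↦ Finset.range d,
        f v * (∏ i, (N (v i) : ℝ) - ((H : ℝ) / d) ^ k) := by
    rw [hsum, blockMean]
    simp only [mul_sub, Finset.sum_sub_distrib, ← Finset.sum_mul, div_pow]
    ring
  rw [hmain]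
  calc _ ≤ ∑ v ∈ Fintype.piFinset fun _ : Fin k ↦ Finset.range d,
        |f v| * (k * (2 * ((H : ℝ) / d)) ^ (k - 1)) :=
        (Finset.abs_sum_le_sum_abs _ _).trans <| Finset.sum_le_sum fun v hv ↦ by
          rw [abs_mul]
          exact mul_le_mul_of_nonneg_left (hdiff v hv) (abs_nonneg _)
    _ = _ := by
        rw [← Finset.sum_mul, blockMean]
        cases k with
        | zero => simp
        | succ j =>
          simp only [Nat.add_sub_cancel, mul_pow, div_pow, pow_succ]
          field_simp

end BlockMean

section EulerExpansion

lemma sqrt_natCast_prod (T : Finset Nat.Primes) :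
    √((∏ p ∈ T, (p : ℕ) : ℕ) : ℝ) = ∏ p ∈ T, √((p : ℕ) : ℝ) := by
  rw [Nat.cast_prod, Real.sqrt_prod _ fun p _ ↦ Nat.cast_nonneg _]

lemma sqrt_natCast_primes_pos (p : Nat.Primes) : 0 < √((p : ℕ) : ℝ) :=
  Real.sqrt_pos.2 (by exact_mod_cast p.2.pos)

lemma natCast_prod_primes_pos (T : Finset Nat.Primes) :
    (0 : ℝ) < ((∏ p ∈ T, (p : ℕ) : ℕ) : ℝ) := by
  exact_mod_cast Finset.prod_pos fun (p : Nat.Primes) _ ↦ p.2.pos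

lemma abs_tprod_one_add_sub_sum_le {x : Nat.Primes → ℝ} {M : ℝ}
    (hM : ∀ F : Finset Nat.Primes, ∏ p ∈ F, (1 + √((p : ℕ) : ℝ) * |x p|) ≤ M)
    {H : ℕ} (hH : 1 ≤ H) {S : Finset (Finset Nat.Primes)}
    (hS : ∀ T ∉ S, H ≤ ∏ p ∈ T, (p : ℕ)) :
    Multipliable (fun p ↦ 1 + x p) ∧
      |∏' p, (1 + x p) - ∑ T ∈ S, ∏ p ∈ T, x p| ≤ (√(H : ℝ))⁻¹ * M := by
  obtain ⟨hv, hvM⟩ := summable_and_tsum_finset_prod_le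
    (f := fun p : Nat.Primes ↦ √((p : ℕ) : ℝ) * |x p|) (fun p ↦ by positivity) hM
  have hv0 : ∀ T : Finset Nat.Primes, 0 ≤ ∏ p ∈ T, √((p : ℕ) : ℝ) * |x p| :=
    fun T ↦ Finset.prod_nonneg fun p _ ↦ by positivity
  have hH0 : 0 < √(H : ℝ) := Real.sqrt_pos.2 (by exact_mod_cast hH)
  have hg : Summable fun T : Finset Nat.Primes ↦ ∏ p ∈ T, x p := by
    refine Summable.of_norm_bounded hv fun T ↦ ?_
    rw [norm_prod]
    refine Finset.prod_le_prod (fun _ _ ↦ norm_nonneg _) fun p _ ↦ ?_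
    rw [Real.norm_eq_abs]
    refine le_mul_of_one_le_left (abs_nonneg _) ?_
    rw [Real.one_le_sqrt]
    exact_mod_cast p.2.one_le
  refine ⟨multipliable_one_add_of_summable_prod hg, ?_⟩
  rw [tprod_one_add hg]
  refine (abs_tsum_sub_sum_le S hg hv hv0 (inv_nonneg.2 hH0.le) fun T hT ↦ ?_).trans
    (mul_le_mul_of_nonneg_left hvM (inv_nonneg.2 hH0.le))
  rw [Finset.prod_mul_distrib, ← sqrt_natCast_prod, ← Finset.abs_prod, ← mul_assoc]
  refine le_mul_of_one_le_left (abs_nonneg _) ?_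
  rw [inv_mul_eq_div, one_le_div hH0]
  exact Real.sqrt_le_sqrt (by exact_mod_cast hS T hT)

lemma sum_abs_prod_le {x : Nat.Primes → ℝ} {M : ℝ}
    (hM : ∀ F : Finset Nat.Primes, ∏ p ∈ F, (1 + (√((p : ℕ) : ℝ))⁻¹ * |x p|) ≤ M)
    {H : ℕ} {S : Finset (Finset Nat.Primes)} (hS : ∀ T ∈ S, ∏ p ∈ T, (p : ℕ) ≤ H) :
    ∑ T ∈ S, |∏ p ∈ T, x p| ≤ √(H : ℝ) * M := by
  obtain ⟨hv, hvM⟩ := summable_and_tsum_finset_prod_le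
    (f := fun p : Nat.Primes ↦ (√((p : ℕ) : ℝ))⁻¹ * |x p|) (fun p ↦ by positivity) hM
  have hv0 : ∀ T : Finset Nat.Primes, 0 ≤ ∏ p ∈ T, (√((p : ℕ) : ℝ))⁻¹ * |x p| :=
    fun T ↦ Finset.prod_nonneg fun p _ ↦ by positivity
  calc ∑ T ∈ S, |∏ p ∈ T, x p|
      ≤ ∑ T ∈ S, √(H : ℝ) * ∏ p ∈ T, (√((p : ℕ) : ℝ))⁻¹ * |x p| := by
        refine Finset.sum_le_sum fun T hT ↦ ?_
        rw [Finset.prod_mul_distrib, Finset.prod_inv_distrib, ← sqrt_natCast_prod,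
          ← Finset.abs_prod, ← mul_assoc]
        refine le_mul_of_one_le_left (abs_nonneg _) ?_
        rw [← div_eq_mul_inv, one_le_div (Real.sqrt_pos.2 (natCast_prod_primes_pos T))]
        exact Real.sqrt_le_sqrt (by exact_mod_cast hS T hT)
    _ ≤ √(H : ℝ) * M := by
        rw [← Finset.mul_sum]
        gcongr
        exact (hv.sum_le_tsum S fun T _ ↦ hv0 T).trans hvM

lemma exists_finset_prod_primes_le (H : ℕ) :
    ∃ S : Finset (Finset Nat.Primes), ∀ T, T ∈ S ↔ ∏ p ∈ T, (p : ℕ) ≤ H := by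
  have hP : {p : Nat.Primes | (p : ℕ) ≤ H}.Finite :=
    (Set.finite_Iic H).preimage Subtype.val_injective.injOn
  have hfin : {T : Finset Nat.Primes | ∏ p ∈ T, (p : ℕ) ≤ H}.Finite := by
    refine (hP.toFinset.powerset.finite_toSet).subset fun T hT ↦ ?_
    rw [Finset.mem_coe, Finset.mem_powerset]
    intro p hp
    rw [Set.Finite.mem_toFinset]
    exact (Nat.le_of_dvd (Finset.prod_pos fun q _ ↦ q.2.pos)
      (Finset.dvd_prod_of_mem (fun q : Nat.Primes ↦ (q : ℕ)) hp)).trans hT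
  exact ⟨hfin.toFinset, fun T ↦ by simp⟩

lemma summable_sqrt_div_sq_primes :
    Summable fun p : Nat.Primes ↦ √((p : ℕ) : ℝ) / ((p : ℕ) : ℝ) ^ 2 := by
  refine (Nat.Primes.summable_rpow (r := -(3 / 2))).2 (by norm_num) |>.congr fun p ↦ ?_
  have hp : (0 : ℝ) < ((p : ℕ) : ℝ) := by exact_mod_cast p.2.pos
  rw [Real.sqrt_eq_rpow, ← Real.rpow_natCast, ← Real.rpow_sub hp]
  norm_num

lemma exists_prod_one_add_sqrt_div_sq_le {A : ℝ} (hA : 0 ≤ A) :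
    ∃ Q : ℝ, 0 ≤ Q ∧ ∀ F : Finset Nat.Primes,
      ∏ p ∈ F, (1 + A * (√((p : ℕ) : ℝ) / ((p : ℕ) : ℝ) ^ 2)) ≤ Q := by
  refine ⟨Real.exp (∑' p : Nat.Primes, A * (√((p : ℕ) : ℝ) / ((p : ℕ) : ℝ) ^ 2)),
    (Real.exp_pos _).le, fun F ↦ ?_⟩
  calc _ ≤ ∏ p ∈ F, Real.exp (A * (√((p : ℕ) : ℝ) / ((p : ℕ) : ℝ) ^ 2)) :=
        Finset.prod_le_prod (fun p _ ↦ by positivity) fun p _ ↦ by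
          rw [add_comm]; exact Real.add_one_le_exp _
    _ ≤ _ := by
        rw [← Real.exp_sum]
        exact Real.exp_le_exp.2 ((summable_sqrt_div_sq_primes.mul_left A).sum_le_tsum F
          fun p _ ↦ by positivity)

end EulerExpansion

section SingularFactor

variable {k : ℕ}

lemma nup_le (t : Fin k → ℕ) (p : ℕ) : nup t p ≤ k := by
  rw [nup, ← Set.image_univ]
  exact (Set.ncard_image_le Set.finite_univ).trans_eq (by simp [Set.ncard_univ])

lemma nup_eq_of_injective {t : Fin k → ℕ} {p : ℕ}
    (h : Function.Injective fun i ↦ (t i : ZMod p)) : nup t p = k := by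
  rw [nup, ← Set.image_univ, Set.ncard_image_of_injective _ h]
  simp [Set.ncard_univ]

lemma residuePeriodic_nup (p : ℕ) (φ : ℕ → ℝ) :
    ResiduePeriodic p fun t : Fin k → ℕ ↦ φ (nup t p) := fun s t hst ↦ by
  have : (fun i ↦ (s i : ZMod p)) = fun i ↦ (t i : ZMod p) := funext hst
  simp only [nup, this]

/-- Deviation from `1` of the `m`-th power of the `p`-factor of the singular series. -/
noncomputable def singDev (m : ℕ) (p : ℕ) (t : Fin k → ℕ) : ℝ := singFactor t p ^ m - 1

lemma residuePeriodic_singDev (m p : ℕ) :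
    ResiduePeriodic p (singDev m p : (Fin k → ℕ) → ℝ) :=
  residuePeriodic_nup p fun ν ↦ ((1 - (ν : ℝ) / p) * (1 - 1 / (p : ℝ)) ^ (-(k : ℤ))) ^ m - 1

open Classical in
lemma exists_abs_singDev_le (k m : ℕ) :
    ∃ A : ℝ, 0 ≤ A ∧ ∀ (p : Nat.Primes) (t : Fin k → ℕ), |singDev m p t| ≤
      A * (1 / ((p : ℕ) : ℝ) ^ 2 +
        if Function.Injective fun i ↦ (t i : ZMod p) then 0 else 1 / ((p : ℕ) : ℝ)) := by
  obtain ⟨A, hA, h⟩ := exists_abs_factor_pow_sub_one_le k m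
  refine ⟨A, hA, fun p t ↦ (h p (nup t p) p.2.two_le (nup_le t p)).trans ?_⟩
  gcongr
  split_ifs with h1 h2 h2
  · exact le_rfl
  · positivity
  · exact absurd (nup_eq_of_injective h2) h1
  · exact le_rfl

open Classical in
lemma blockMean_abs_singDev_le {m : ℕ} {A : ℝ} (hA : 0 ≤ A) (p : Nat.Primes)
    (h : ∀ t : Fin k → ℕ, |singDev m p t| ≤ A * (1 / ((p : ℕ) : ℝ) ^ 2 +
      if Function.Injective fun i ↦ (t i : ZMod p) then 0 else 1 / ((p : ℕ) : ℝ))) :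
    blockMean (p : ℕ) (fun t : Fin k → ℕ ↦ |singDev m p t|) ≤
      A * (1 + k ^ 2) / ((p : ℕ) : ℝ) ^ 2 := by
  have hp : (0 : ℝ) < ((p : ℕ) : ℝ) := by exact_mod_cast p.2.pos
  set R := Fintype.piFinset fun _ : Fin k ↦ Finset.range (p : ℕ) with hR
  have hcard := card_filter_not_injective_le (Finset.range (p : ℕ)) k
  rw [Finset.card_range, ← hR] at hcard
  have hcard' : ((R.filter fun t ↦ ¬ Function.Injective t).card : ℝ) ≤
      k ^ 2 * ((p : ℕ) : ℝ) ^ (k - 1) := by exact_mod_cast hcard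
  have hinj : ∀ t ∈ R, Function.Injective t → Function.Injective fun i ↦ (t i : ZMod p) :=
    fun t ht hti i j hij ↦ hti <| by
      have hlt : ∀ i, t i < p := fun i ↦ Finset.mem_range.1 (Fintype.mem_piFinset.1 ht i)
      have := congrArg ZMod.val hij
      simpa only [ZMod.val_cast_of_lt (hlt _)] using this
  rw [blockMean, div_le_iff₀ (by positivity)]
  calc ∑ t ∈ R, |singDev m p t|
      ≤ ∑ t ∈ R, A * (1 / ((p : ℕ) : ℝ) ^ 2 +
          if ¬ Function.Injective t then 1 / ((p : ℕ) : ℝ) else 0) := by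
        refine Finset.sum_le_sum fun t ht ↦ (h t).trans ?_
        gcongr
        by_cases h2 : Function.Injective t
        · simp [hinj t ht h2, h2]
        · rw [if_pos h2]
          split_ifs
          · positivity
          · exact le_rfl
    _ = A * ((p : ℕ) ^ k / ((p : ℕ) : ℝ) ^ 2 +
          (R.filter fun t ↦ ¬ Function.Injective t).card / ((p : ℕ) : ℝ)) := by
        rw [← Finset.mul_sum, Finset.sum_add_distrib, Finset.sum_ite]
        simp [hR, div_eq_mul_inv]
    _ ≤ A * ((p : ℕ) ^ k / ((p : ℕ) : ℝ) ^ 2 +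
          k ^ 2 * ((p : ℕ) : ℝ) ^ (k - 1) / ((p : ℕ) : ℝ)) := by gcongr
    _ = A * (1 + k ^ 2) / ((p : ℕ) : ℝ) ^ 2 * (p : ℕ) ^ k := by
        cases k with
        | zero => simp [div_eq_mul_inv]
        | succ j =>
          rw [Nat.add_sub_cancel]
          field_simp
          ring

lemma muFactor_eq (k m : ℕ) (p : Nat.Primes) :
    muFactor k m p = 1 + blockMean (p : ℕ) (singDev m p : (Fin k → ℕ) → ℝ) := by
  have : NeZero (p : ℕ) := ⟨p.2.ne_zero⟩
  have hp : (0 : ℝ) < ((p : ℕ) : ℝ) := by exact_mod_cast p.2.pos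
  have hterm : ∀ u : Fin k → ZMod p, singDev m p (fun i ↦ (u i).val) =
      (1 - 1 / ((p : ℕ) : ℝ)) ^ (-((k * m : ℕ) : ℤ)) *
        (1 - ((Set.range u).ncard : ℝ) / ((p : ℕ) : ℝ)) ^ m - 1 := fun u ↦ by
    have hn : nup (fun i ↦ (u i).val) p = (Set.range u).ncard := by
      simp only [nup, ZMod.natCast_zmod_val]
    rw [singDev, singFactor, hn, mul_pow, mul_comm, ← zpow_natCast, ← zpow_mul]
    push_cast
    rw [neg_mul]
  rw [muFactor, halfTerm, blockMean, sum_piFinset_range]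
  simp only [hterm, Finset.sum_sub_distrib, ← Finset.mul_sum, zpow_neg, zpow_natCast]
  simp only [Finset.sum_const, Finset.card_univ, Fintype.card_pi, ZMod.card, Finset.prod_const,
    Fintype.card_fin, nsmul_eq_mul, mul_one, Nat.cast_pow]
  field_simp
  ring

lemma exists_nat_dvd_of_not_injective {H : ℕ} {t : Fin k → ℕ} (ht : t ∈ distinctTuples k H) :
    ∃ n : ℕ, n ≠ 0 ∧ n ≤ H ^ k ^ 2 ∧
      ∀ p : ℕ, ¬ Function.Injective (fun i ↦ (t i : ZMod p)) → p ∣ n := by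
  rw [distinctTuples, Finset.mem_filter, Fintype.mem_piFinset] at ht
  obtain ⟨hbox, hinj⟩ := ht
  simp only [Finset.mem_Icc] at hbox
  refine ⟨∏ ij ∈ (Finset.univ : Finset (Fin k)).offDiag, ((t ij.1 : ℤ) - t ij.2).natAbs,
    ?_, ?_, ?_⟩
  · refine Finset.prod_ne_zero_iff.2 fun ij hij ↦ ?_
    have := hinj.ne (Finset.mem_offDiag.1 hij).2.2
    omega
  · by_cases hk : k = 0
    · subst hk; simp
    have hH : 1 ≤ H := (hbox ⟨0, Nat.pos_of_ne_zero hk⟩).1.trans (hbox _).2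
    calc _ ≤ ∏ ij ∈ (Finset.univ : Finset (Fin k)).offDiag, H :=
          Finset.prod_le_prod' fun ij _ ↦ by
            have := hbox ij.1; have := hbox ij.2; omega
      _ ≤ H ^ k ^ 2 := by
          rw [Finset.prod_const]
          refine Nat.pow_le_pow_right hH ?_
          rw [Finset.offDiag_card, Finset.card_univ, Fintype.card_fin, sq]
          exact Nat.sub_le _ _
  · intro p hp
    rw [Function.Injective] at hp
    push Not at hp
    obtain ⟨i, j, hij, hne⟩ := hp
    refine dvd_trans ?_ (Finset.dvd_prod_of_mem _
      (show (i, j) ∈ _ from Finset.mem_offDiag.2 ⟨Finset.mem_univ i, Finset.mem_univ j, hne⟩))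
    rw [← Int.natCast_dvd, ← ZMod.intCast_zmod_eq_zero_iff_dvd]
    simpa [sub_eq_zero] using hij

end SingularFactor

section ProductBounds

variable {k : ℕ}

lemma prod_ite_mem_primeFactors_le {A : ℝ} (hA : 1 ≤ A) (n : ℕ) (F : Finset Nat.Primes) :
    ∏ p ∈ F, (if (p : ℕ) ∈ n.primeFactors then A else 1) ≤ A ^ n.primeFactors.card := by
  rw [Finset.prod_ite]
  simp only [Finset.prod_const, one_pow, mul_one]
  exact pow_le_pow_right₀ hA <| Finset.card_le_card_of_injOn (fun p : Nat.Primes ↦ (p : ℕ))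
    (fun p hp ↦ (Finset.mem_filter.1 hp).2) Subtype.val_injective.injOn

lemma exists_prod_sqrt_mul_abs_singDev_le (k m : ℕ) (hk : 1 ≤ k) {ε : ℝ} (hε : 0 < ε) :
    ∃ M : ℝ, 0 ≤ M ∧ ∀ H : ℕ, ∀ t ∈ distinctTuples k H, ∀ F : Finset Nat.Primes,
      ∏ p ∈ F, (1 + √((p : ℕ) : ℝ) * |singDev m p t|) ≤ M * (H : ℝ) ^ ε := by
  classical
  obtain ⟨A, hA, hdev⟩ := exists_abs_singDev_le k m
  obtain ⟨Q, hQ, hQF⟩ := exists_prod_one_add_sqrt_div_sq_le hA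
  have hk2 : (0 : ℝ) < (k : ℝ) ^ 2 := by positivity
  obtain ⟨K, hK, hKn⟩ := exists_pow_card_primeFactors_le (A := 1 + A) (δ := ε / (k : ℝ) ^ 2)
    (by linarith) (by positivity)
  refine ⟨Q * K, by positivity, fun H t ht F ↦ ?_⟩
  obtain ⟨n, hn0, hnH, hn⟩ := exists_nat_dvd_of_not_injective ht
  have hfac : ∀ p : Nat.Primes, 1 + √((p : ℕ) : ℝ) * |singDev m p t| ≤
      (1 + A * (√((p : ℕ) : ℝ) / ((p : ℕ) : ℝ) ^ 2)) *
        if (p : ℕ) ∈ n.primeFactors then 1 + A else 1 := fun p ↦ by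
    have hp1 : (1 : ℝ) ≤ ((p : ℕ) : ℝ) := by exact_mod_cast p.2.one_le
    have hsq : √((p : ℕ) : ℝ) * (1 / ((p : ℕ) : ℝ)) ≤ 1 := by
      rw [mul_one_div, div_le_one (by linarith)]
      exact Real.sqrt_le_iff.2 ⟨by linarith, by nlinarith⟩
    have hs := mul_le_mul_of_nonneg_left (hdev p t) (Real.sqrt_nonneg ((p : ℕ) : ℝ))
    set c := √((p : ℕ) : ℝ) / ((p : ℕ) : ℝ) ^ 2 with hc
    have hc0 : 0 ≤ c := by positivity
    by_cases hinj : Function.Injective fun i ↦ (t i : ZMod p)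
    · rw [if_pos hinj, add_zero, show √((p : ℕ) : ℝ) * (A * (1 / ((p : ℕ) : ℝ) ^ 2)) = A * c by
        rw [hc]; ring] at hs
      have hAc : 0 ≤ A * c := by positivity
      split_ifs
      · nlinarith
      · linarith
    · rw [if_neg hinj, show √((p : ℕ) : ℝ) * (A * (1 / ((p : ℕ) : ℝ) ^ 2 + 1 / ((p : ℕ) : ℝ))) =
        A * c + A * (√((p : ℕ) : ℝ) * (1 / ((p : ℕ) : ℝ))) by rw [hc]; ring] at hs
      rw [if_pos (Nat.mem_primeFactors.2 ⟨p.2, hn p hinj, hn0⟩)]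
      have := mul_le_mul_of_nonneg_left hsq hA
      have h2 : 0 ≤ A * c * A := by positivity
      linarith
  calc _ ≤ ∏ p ∈ F, ((1 + A * (√((p : ℕ) : ℝ) / ((p : ℕ) : ℝ) ^ 2)) *
        if (p : ℕ) ∈ n.primeFactors then 1 + A else 1) :=
        Finset.prod_le_prod (fun p _ ↦ by positivity) fun p _ ↦ hfac p
    _ ≤ Q * (K * (H : ℝ) ^ ε) := by
        rw [Finset.prod_mul_distrib]
        refine mul_le_mul (hQF F) ?_ (Finset.prod_nonneg fun p _ ↦ by positivity) hQ
        refine (prod_ite_mem_primeFactors_le (by linarith) n F).trans ((hKn n hn0).trans ?_)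
        gcongr
        calc (n : ℝ) ^ (ε / (k : ℝ) ^ 2) ≤ ((H : ℝ) ^ k ^ 2) ^ (ε / (k : ℝ) ^ 2) := by
              gcongr; exact_mod_cast hnH
          _ = (H : ℝ) ^ ε := by
              rw [← Real.rpow_natCast, ← Real.rpow_mul (Nat.cast_nonneg H)]
              congr 1
              push_cast
              field_simp
    _ = _ := by ring

lemma exists_prod_inv_sqrt_mul_abs_singDev_le (k m : ℕ) :
    ∃ M : ℝ, 0 ≤ M ∧ ∀ (t : Fin k → ℕ) (F : Finset Nat.Primes),
      ∏ p ∈ F, (1 + (√((p : ℕ) : ℝ))⁻¹ * |singDev m p t|) ≤ M := by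
  classical
  obtain ⟨A, hA, hdev⟩ := exists_abs_singDev_le k m
  obtain ⟨Q, hQ, hQF⟩ := exists_prod_one_add_sqrt_div_sq_le (A := 2 * A) (by positivity)
  refine ⟨Q, hQ, fun t F ↦ le_trans ?_ (hQF F)⟩
  refine Finset.prod_le_prod (fun p _ ↦ by positivity) fun p _ ↦ ?_
  have hp1 : (1 : ℝ) ≤ ((p : ℕ) : ℝ) := by exact_mod_cast p.2.one_le
  have hs := sqrt_natCast_primes_pos p
  have hle : |singDev m p t| ≤ 2 * A * (1 / ((p : ℕ) : ℝ)) := by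
    have h1 : 1 / ((p : ℕ) : ℝ) ^ 2 ≤ 1 / ((p : ℕ) : ℝ) := by
      gcongr
      nlinarith
    calc _ ≤ _ := hdev p t
      _ ≤ A * (1 / ((p : ℕ) : ℝ) + 1 / ((p : ℕ) : ℝ)) := by
        gcongr
        split_ifs
        · positivity
        · exact le_rfl
      _ = _ := by ring
  have hw : (√((p : ℕ) : ℝ))⁻¹ * (1 / ((p : ℕ) : ℝ)) = √((p : ℕ) : ℝ) / ((p : ℕ) : ℝ) ^ 2 := by
    field_simp
    rw [Real.sq_sqrt (by linarith)]
  gcongr 1 + ?_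
  calc _ ≤ (√((p : ℕ) : ℝ))⁻¹ * (2 * A * (1 / ((p : ℕ) : ℝ))) := by gcongr
    _ = 2 * A * ((√((p : ℕ) : ℝ))⁻¹ * (1 / ((p : ℕ) : ℝ))) := by ring
    _ = _ := by rw [hw]

lemma exists_prod_sqrt_mul_blockMean_le (k m : ℕ) :
    ∃ M : ℝ, 0 ≤ M ∧ ∀ F : Finset Nat.Primes, ∏ p ∈ F, (1 + √((p : ℕ) : ℝ) *
      blockMean (p : ℕ) fun t : Fin k → ℕ ↦ |singDev m p t|) ≤ M := by
  classical
  obtain ⟨A, hA, hdev⟩ := exists_abs_singDev_le k m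
  obtain ⟨Q, hQ, hQF⟩ := exists_prod_one_add_sqrt_div_sq_le (A := A * (1 + (k : ℝ) ^ 2))
    (by positivity)
  refine ⟨Q, hQ, fun F ↦ le_trans ?_ (hQF F)⟩
  refine Finset.prod_le_prod (fun p _ ↦ ?_) fun p _ ↦ ?_
  · have := blockMean_nonneg (n := (p : ℕ)) (f := fun t : Fin k → ℕ ↦ |singDev m p t|)
      fun t ↦ abs_nonneg _
    positivity
  · gcongr 1 + ?_
    calc _ ≤ √((p : ℕ) : ℝ) * (A * (1 + (k : ℝ) ^ 2) / ((p : ℕ) : ℝ) ^ 2) := by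
          gcongr
          exact blockMean_abs_singDev_le hA p (hdev p)
      _ = _ := by ring

end ProductBounds

section Moments

variable {k : ℕ}

lemma singSeries_pow_eq (hk : 1 ≤ k) {H : ℕ} {t : Fin k → ℕ} (ht : t ∈ distinctTuples k H)
    (m : ℕ) : singSeries t ^ m = ∏' p : Nat.Primes, (1 + singDev m p t) := by
  obtain ⟨M, -, hM⟩ := exists_prod_sqrt_mul_abs_singDev_le k 1 hk one_pos
  obtain ⟨S, hS⟩ := exists_finset_prod_primes_le 1
  have hmul := (abs_tprod_one_add_sub_sum_le (hM H t ht) le_rfl (S := S) fun T hT ↦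
    (not_le.1 (mt (hS T).2 hT)).le).1
  have hmul' : Multipliable fun p : Nat.Primes ↦ singFactor t p :=
    hmul.congr fun p ↦ by simp [singDev]
  rw [singSeries, ← hmul'.tprod_pow]
  simp [singDev]

lemma card_box_sub_card_distinctTuples (k H : ℕ) :
    |(H : ℝ) ^ k - ((distinctTuples k H).card : ℝ)| ≤ (k : ℝ) ^ 2 * (H : ℝ) ^ (k - 1) := by
  have hcard := card_filter_not_injective_le (Finset.Icc 1 H) k
  have hsplit := Finset.card_filter_add_card_filter_not
    (s := Fintype.piFinset fun _ : Fin k ↦ Finset.Icc 1 H) Function.Injective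
  rw [Fintype.card_piFinset_const, Nat.card_Icc, Nat.add_sub_cancel] at hsplit
  rw [Nat.card_Icc, Nat.add_sub_cancel] at hcard
  have h1 : (H : ℝ) ^ k - ((distinctTuples k H).card : ℝ) =
      (((Fintype.piFinset fun _ : Fin k ↦ Finset.Icc 1 H).filter
        fun t ↦ ¬ Function.Injective t).card : ℝ) := by
    rw [distinctTuples, sub_eq_iff_eq_add']
    exact_mod_cast hsplit.symm
  rw [h1, Nat.abs_cast]
  exact_mod_cast hcard

/-- The sum over a box of the truncated divisor expansion, compared with its mean value. -/
lemma abs_sum_box_sub_le {m : ℕ} {M : ℝ}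
    (hM : ∀ F : Finset Nat.Primes, ∏ p ∈ F, (1 + √((p : ℕ) : ℝ) *
      blockMean (p : ℕ) fun t : Fin k → ℕ ↦ |singDev m p t|) ≤ M)
    {H : ℕ} {S : Finset (Finset Nat.Primes)} (hS : ∀ T ∈ S, ∏ p ∈ T, (p : ℕ) ≤ H) :
    |∑ t ∈ Fintype.piFinset fun _ : Fin k ↦ Finset.Icc 1 H, ∑ T ∈ S, ∏ p ∈ T, singDev m p t -
      (H : ℝ) ^ k * ∑ T ∈ S, ∏ p ∈ T, blockMean (p : ℕ) (singDev m p : (Fin k → ℕ) → ℝ)| ≤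
      k * 2 ^ (k - 1) * (H : ℝ) ^ (k - 1) * (√(H : ℝ) * M) := by
  have hnn : ∀ p : Nat.Primes, 0 ≤ blockMean (p : ℕ) fun t : Fin k → ℕ ↦ |singDev m p t| :=
    fun p ↦ blockMean_nonneg fun t ↦ abs_nonneg _
  have hper : ∀ p : Nat.Primes, ResiduePeriodic (p : ℕ) (singDev m p : (Fin k → ℕ) → ℝ) :=
    fun p ↦ residuePeriodic_singDev m p
  have hterm : ∀ T ∈ S,
      |∑ t ∈ Fintype.piFinset fun _ : Fin k ↦ Finset.Icc 1 H, ∏ p ∈ T, singDev m p t -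
        (H : ℝ) ^ k * ∏ p ∈ T, blockMean (p : ℕ) (singDev m p : (Fin k → ℕ) → ℝ)| ≤
      k * 2 ^ (k - 1) * (H : ℝ) ^ (k - 1) * |∏ p ∈ T, ((p : ℕ) : ℝ) *
        blockMean (p : ℕ) (fun t : Fin k → ℕ ↦ |singDev m p t|)| := fun T hT ↦ by
    have h := abs_sum_box_sub_blockMean_le (k := k) (H := H)
      (d := ∏ p ∈ T, (p : ℕ)) (Finset.prod_pos fun p _ ↦ p.2.pos) (hS T hT)
      (f := fun t ↦ ∏ p ∈ T, singDev m p t)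
      (ResiduePeriodic.prod fun p hp ↦ (hper p).of_dvd
        (Finset.dvd_prod_of_mem (fun q : Nat.Primes ↦ (q : ℕ)) hp))
    simp only [Finset.abs_prod] at h
    rw [blockMean_prod T hper, blockMean_prod T fun p ↦ (hper p).abs] at h
    refine h.trans_eq ?_
    rw [abs_of_nonneg (Finset.prod_nonneg fun p _ ↦ mul_nonneg (Nat.cast_nonneg _) (hnn p)),
      Finset.prod_mul_distrib, Nat.cast_prod, mul_assoc]
  have hweight : ∀ F : Finset Nat.Primes, ∏ p ∈ F, (1 + (√((p : ℕ) : ℝ))⁻¹ * |((p : ℕ) : ℝ) *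
      blockMean (p : ℕ) (fun t : Fin k → ℕ ↦ |singDev m p t|)|) ≤ M := fun F ↦ by
    refine le_of_eq_of_le (Finset.prod_congr rfl fun p _ ↦ ?_) (hM F)
    rw [abs_of_nonneg (mul_nonneg (Nat.cast_nonneg _) (hnn p)), ← mul_assoc, inv_mul_eq_div,
      Real.div_sqrt]
  rw [Finset.sum_comm, Finset.mul_sum, ← Finset.sum_sub_distrib]
  calc _ ≤ _ := Finset.abs_sum_le_sum_abs _ _
    _ ≤ _ := Finset.sum_le_sum hterm
    _ ≤ _ := by
      rw [← Finset.mul_sum]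
      gcongr
      exact sum_abs_prod_le hweight hS

lemma exists_moments_le_nat (k m : ℕ) (hk : 1 ≤ k) {ε : ℝ} (hε : 0 < ε) :
    ∃ C : ℝ, 0 ≤ C ∧ ∀ H : ℕ, 1 ≤ H →
      |(∑ t ∈ distinctTuples k H, singSeries t ^ m) -
          muMoment k m * ((distinctTuples k H).card : ℝ)| ≤
        C * ((H : ℝ) ^ (k - 1) * √(H : ℝ) * (H : ℝ) ^ ε) := by
  obtain ⟨M₁, hM₁, hdist⟩ := exists_prod_sqrt_mul_abs_singDev_le k m hk hε
  obtain ⟨M₂, hM₂, hall⟩ := exists_prod_inv_sqrt_mul_abs_singDev_le k m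
  obtain ⟨M₃, hM₃, hmean⟩ := exists_prod_sqrt_mul_blockMean_le k m
  refine ⟨M₁ + k * 2 ^ (k - 1) * M₃ + k ^ 2 * M₂ + M₃ + |muMoment k m| * k ^ 2, by positivity,
    fun H hH ↦ ?_⟩
  obtain ⟨S, hS⟩ := exists_finset_prod_primes_le H
  have hSle : ∀ T ∈ S, ∏ p ∈ T, (p : ℕ) ≤ H := fun T ↦ (hS T).1
  have hSge : ∀ T ∉ S, H ≤ ∏ p ∈ T, (p : ℕ) := fun T hT ↦ (not_le.1 (mt (hS T).2 hT)).le
  set B := Fintype.piFinset fun _ : Fin k ↦ Finset.Icc 1 H with hB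
  set G : (Fin k → ℕ) → ℝ := fun t ↦ ∑ T ∈ S, ∏ p ∈ T, singDev m p t with hG
  set E : ℝ := ∑ T ∈ S, ∏ p ∈ T, blockMean (p : ℕ) (singDev m p : (Fin k → ℕ) → ℝ) with hE
  have hH1 : (1 : ℝ) ≤ H := by exact_mod_cast hH
  have hHε : 1 ≤ (H : ℝ) ^ ε := Real.one_le_rpow hH1 hε.le
  have hs1 : 1 ≤ √(H : ℝ) := Real.one_le_sqrt.2 hH1
  set Y : ℝ := (H : ℝ) ^ (k - 1) with hY
  have hY0 : 0 ≤ Y := by positivity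
  have hpow : (H : ℝ) ^ k * (√(H : ℝ))⁻¹ = Y * √(H : ℝ) := by
    rw [← div_eq_mul_inv, div_eq_iff (by positivity), mul_assoc, Real.mul_self_sqrt (by positivity),
      hY, ← pow_succ, Nat.sub_add_cancel hk]
  have hcardB : (B.card : ℝ) = (H : ℝ) ^ k := by simp [hB]
  have hsub : distinctTuples k H ⊆ B := Finset.filter_subset _ _
  have h1 : |∑ t ∈ distinctTuples k H, (singSeries t ^ m - G t)| ≤
      Y * √(H : ℝ) * (M₁ * (H : ℝ) ^ ε) := by
    calc _ ≤ _ := Finset.abs_sum_le_sum_abs _ _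
      _ ≤ ∑ t ∈ distinctTuples k H, (√(H : ℝ))⁻¹ * (M₁ * (H : ℝ) ^ ε) :=
        Finset.sum_le_sum fun t ht ↦ by
          rw [singSeries_pow_eq hk ht m]
          exact (abs_tprod_one_add_sub_sum_le (hdist H t ht) hH hSge).2
      _ ≤ (H : ℝ) ^ k * ((√(H : ℝ))⁻¹ * (M₁ * (H : ℝ) ^ ε)) := by
        rw [Finset.sum_const, nsmul_eq_mul, ← hcardB]
        gcongr
      _ = _ := by rw [← mul_assoc, hpow]
  have h2 : |∑ t ∈ B, G t - (H : ℝ) ^ k * E| ≤ k * 2 ^ (k - 1) * Y * (√(H : ℝ) * M₃) :=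
    abs_sum_box_sub_le hmean hSle
  have h3 : |∑ t ∈ B.filter fun t ↦ ¬ Function.Injective t, G t| ≤
      k ^ 2 * Y * (√(H : ℝ) * M₂) := by
    have hcard := card_filter_not_injective_le (Finset.Icc 1 H) k
    rw [Nat.card_Icc, Nat.add_sub_cancel, ← hB] at hcard
    have hcard' : ((B.filter fun t ↦ ¬ Function.Injective t).card : ℝ) ≤ k ^ 2 * Y := by
      rw [hY]; exact_mod_cast hcard
    calc _ ≤ _ := Finset.abs_sum_le_sum_abs _ _
      _ ≤ ∑ t ∈ B.filter fun t ↦ ¬ Function.Injective t, √(H : ℝ) * M₂ :=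
        Finset.sum_le_sum fun t _ ↦
          (Finset.abs_sum_le_sum_abs _ _).trans (sum_abs_prod_le (hall t) hSle)
      _ ≤ _ := by
        rw [Finset.sum_const, nsmul_eq_mul]
        gcongr
  have h4 : |muMoment k m - E| ≤ (√(H : ℝ))⁻¹ * M₃ := by
    have hmean' : ∀ F : Finset Nat.Primes, ∏ p ∈ F, (1 + √((p : ℕ) : ℝ) *
        |blockMean (p : ℕ) (singDev m p : (Fin k → ℕ) → ℝ)|) ≤ M₃ := fun F ↦ by
      refine le_trans (Finset.prod_le_prod (fun p _ ↦ by positivity) fun p _ ↦ ?_) (hmean F)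
      gcongr
      exact abs_blockMean_le _ _
    simp only [muMoment, muFactor_eq]
    exact (abs_tprod_one_add_sub_sum_le hmean' hH hSge).2
  have h4' : |(H : ℝ) ^ k * (muMoment k m - E)| ≤ Y * √(H : ℝ) * M₃ := by
    rw [abs_mul, abs_of_nonneg (by positivity : (0 : ℝ) ≤ (H : ℝ) ^ k), ← hpow, mul_assoc]
    gcongr
  have h5 : |muMoment k m * ((H : ℝ) ^ k - ((distinctTuples k H).card : ℝ))| ≤
      |muMoment k m| * (k ^ 2 * Y) := by
    rw [abs_mul]
    gcongr
    exact card_box_sub_card_distinctTuples k H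
  have hsplit : ∑ t ∈ distinctTuples k H, G t +
      ∑ t ∈ B.filter fun t ↦ ¬ Function.Injective t, G t = ∑ t ∈ B, G t :=
    Finset.sum_filter_add_sum_filter_not _ _ _
  rw [Finset.sum_sub_distrib] at h1
  have hX : Y * √(H : ℝ) ≤ Y * √(H : ℝ) * (H : ℝ) ^ ε := le_mul_of_one_le_right (by positivity) hHε
  have hYX : Y ≤ Y * √(H : ℝ) * (H : ℝ) ^ ε := (le_mul_of_one_le_right hY0 hs1).trans hX
  set X := Y * √(H : ℝ) * (H : ℝ) ^ ε with hXdef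
  have e1 : Y * √(H : ℝ) * (M₁ * (H : ℝ) ^ ε) = M₁ * X := by rw [hXdef]; ring
  have e2 : k * 2 ^ (k - 1) * Y * (√(H : ℝ) * M₃) ≤ k * 2 ^ (k - 1) * M₃ * X := by
    rw [show k * 2 ^ (k - 1) * Y * (√(H : ℝ) * M₃) =
      k * 2 ^ (k - 1) * M₃ * (Y * √(H : ℝ)) by ring]
    gcongr
  have e3 : k ^ 2 * Y * (√(H : ℝ) * M₂) ≤ k ^ 2 * M₂ * X := by
    rw [show k ^ 2 * Y * (√(H : ℝ) * M₂) = k ^ 2 * M₂ * (Y * √(H : ℝ)) by ring]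
    gcongr
  have e4 : Y * √(H : ℝ) * M₃ ≤ M₃ * X := by rw [mul_comm]; gcongr
  have e5 : |muMoment k m| * (k ^ 2 * Y) ≤ |muMoment k m| * k ^ 2 * X := by
    rw [← mul_assoc]; gcongr
  rw [abs_le] at h1 h2 h3 h4' h5 ⊢
  constructor <;> linarith [h1.1, h1.2, h2.1, h2.2, h3.1, h3.2, h4'.1, h4'.2, h5.1, h5.2]

end Moments

/-- Quantitative version: for fixed `k, m ≥ 1` and `ε > 0`, there is `C ≥ 0` (depending
only on `k`, `m`, `ε`) with `|Σ* S(h)^m − μ_k(m)·h*_k| ≤ C·h^(k - 1/2 + ε)` for all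
real `h ≥ 1`, where `h*_k` is the number of `k`-tuples of distinct positive integers
with entries at most `h`. -/
theorem moments_quantitative (k m : ℕ) (hk : 1 ≤ k) (hm : 1 ≤ m)
    (ε : ℝ) (hε : 0 < ε) :
    ∃ C : ℝ, 0 ≤ C ∧ ∀ h : ℝ, 1 ≤ h →
      |(∑ t ∈ distinctTuples k ⌊h⌋₊, singSeries t ^ m) -
          muMoment k m * ((distinctTuples k ⌊h⌋₊).card : ℝ)| ≤
        C * h ^ ((k : ℝ) - 1 / 2 + ε) := by
  obtain ⟨C, hC, hCH⟩ := exists_moments_le_nat k m hk hε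
  refine ⟨C, hC, fun h hh ↦ (hCH ⌊h⌋₊ (Nat.floor_pos.2 hh)).trans ?_⟩
  have hk' : (1 : ℝ) ≤ k := by exact_mod_cast hk
  have hfl : (1 : ℝ) ≤ (⌊h⌋₊ : ℝ) := by exact_mod_cast Nat.floor_pos.2 hh
  have hpow : (⌊h⌋₊ : ℝ) ^ (k - 1) * √(⌊h⌋₊ : ℝ) * (⌊h⌋₊ : ℝ) ^ ε =
      (⌊h⌋₊ : ℝ) ^ ((k : ℝ) - 1 / 2 + ε) := by
    rw [Real.sqrt_eq_rpow, ← Real.rpow_natCast, ← Real.rpow_add (by linarith),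
      ← Real.rpow_add (by linarith)]
    congr 1
    push_cast [Nat.cast_sub hk]
    ring
  rw [hpow]
  gcongr
  · linarith
  · exact Nat.floor_le (by linarith)
end

section
/- For every prime p, every integer k ≥ 1 and every real number m ≥ 1, one has p^{−k} · Σ_{u ∈ (ℤ/pℤ)^k} (1 − ρ_p(u)/p)^m ≥ (1 − 1/p)^{mk}. (Equivalently, every p-factor of the Euler product defining μ_k(m) is ≥ 1.) -/
open Filter Topology

/-- `p^(-k) * Σ_{u ∈ (ℤ/p)^k} (1 - ρ_p(u)/p)^m` for a real exponent `m` (real power),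
where `ρ_p(u)` is the number of distinct components of `u`. -/
noncomputable def halfTermR (k : ℕ) (m : ℝ) (p : Nat.Primes) : ℝ :=
  haveI : NeZero (p : ℕ) := ⟨p.2.ne_zero⟩
  ((p : ℕ) : ℝ) ^ (-(k : ℤ)) *
    ∑ u : Fin k → ZMod (p : ℕ), (1 - ((Set.range u).ncard : ℝ) / ((p : ℕ) : ℝ)) ^ m

/-- Counting pairs `(u, x)` with `x ∉ range u` in two ways. -/
theorem sum_card_sub_ncard_range (ι α : Type*) [Fintype ι] [DecidableEq ι] [Fintype α] :
    ∑ u : ι → α, ((Fintype.card α : ℝ) - (Set.range u).ncard) =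
      Fintype.card α * ((Fintype.card α : ℝ) - 1) ^ Fintype.card ι := by
  classical
  have hcompl (u : ι → α) : (Fintype.card α : ℝ) - (Set.range u).ncard =
      ∑ x : α, ∏ i, if u i = x then (0 : ℝ) else 1 := by
    have hprod (x : α) : (∏ i, if u i = x then (0 : ℝ) else 1) =
        1 - if x ∈ Set.range u then 1 else 0 := by
      by_cases hx : x ∈ Set.range u
      · obtain ⟨i, hi⟩ := hx
        rw [Finset.prod_eq_zero (Finset.mem_univ i) (by simp [hi])]
        simp [← hi]
      · rw [if_neg hx, sub_zero]
        exact Finset.prod_eq_one fun i _ => if_neg fun hi => hx ⟨i, hi⟩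
    simp_rw [hprod, Finset.sum_sub_distrib]
    simp [Set.ncard_eq_toFinset_card']
  have hone (x : α) : (∑ y : α, if y = x then (0 : ℝ) else 1) = Fintype.card α - 1 := by
    have (y : α) : (if y = x then (0 : ℝ) else 1) = 1 - if y = x then 1 else 0 := by
      split_ifs <;> simp
    simp [this]
  have hswap (x : α) : ∑ u : ι → α, ∏ i, (if u i = x then (0 : ℝ) else 1) =
      ((Fintype.card α : ℝ) - 1) ^ Fintype.card ι := by
    rw [← Fintype.prod_sum fun (_ : ι) (y : α) => if y = x then (0 : ℝ) else 1]
    simp [hone]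
  simp_rw [hcompl]
  rw [Finset.sum_comm]
  simp [hswap]

/-- The mean over `u : ι → α` of the proportion of elements of `α` missed by `u`. -/
theorem mean_one_sub_ncard_range_div (ι α : Type*) [Fintype ι] [DecidableEq ι] [Fintype α]
    [Nonempty α] :
    ∑ u : ι → α, ((Fintype.card α : ℝ) ^ Fintype.card ι)⁻¹ *
        (1 - ((Set.range u).ncard : ℝ) / Fintype.card α) =
      (1 - 1 / (Fintype.card α : ℝ)) ^ Fintype.card ι := by
  have hq : (Fintype.card α : ℝ) ≠ 0 := by exact_mod_cast Fintype.card_ne_zero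
  simp_rw [one_sub_div hq]
  rw [← Finset.mul_sum, ← Finset.sum_div, sum_card_sub_ncard_range, div_pow,
    mul_div_cancel_left₀ _ hq, inv_mul_eq_div]

/-- Every `p`-factor of the Euler product defining `μ_k(m)` is at least `1`:
`p^(-k) Σ_{u ∈ (ℤ/p)^k} (1 - ρ_p(u)/p)^m ≥ (1 - 1/p)^(mk)` for every prime `p`,
integer `k ≥ 1` and real `m ≥ 1`. -/
theorem factor_ge_one (p : Nat.Primes) (k : ℕ) (hk : 1 ≤ k) (m : ℝ) (hm : 1 ≤ m) :
    (1 - 1 / ((p : ℕ) : ℝ)) ^ (m * k) ≤ halfTermR k m p := by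
  have : NeZero (p : ℕ) := ⟨p.2.ne_zero⟩
  have hp : (1 : ℝ) ≤ (p : ℕ) := by exact_mod_cast p.2.one_le
  have hmean := mean_one_sub_ncard_range_div (Fin k) (ZMod (p : ℕ))
  simp only [ZMod.card, Fintype.card_fin] at hmean
  have hnonneg (u : Fin k → ZMod (p : ℕ)) :
      0 ≤ 1 - ((Set.range u).ncard : ℝ) / ((p : ℕ) : ℝ) := by
    have hle : (Set.range u).ncard ≤ (p : ℕ) := by
      simpa [Nat.card_eq_fintype_card, ZMod.card] using Set.ncard_le_card (Set.range u)
    rw [sub_nonneg]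
    exact div_le_one_of_le₀ (by exact_mod_cast hle) (by positivity)
  have hjensen := Real.rpow_arith_mean_le_arith_mean_rpow Finset.univ
    (fun _ : Fin k → ZMod (p : ℕ) => (((p : ℕ) : ℝ) ^ k)⁻¹)
    (fun u => 1 - ((Set.range u).ncard : ℝ) / ((p : ℕ) : ℝ))
    (fun _ _ => by positivity) (by simp [ZMod.card]) (fun u _ => hnonneg u) hm
  have hbase : 0 ≤ 1 - 1 / ((p : ℕ) : ℝ) := sub_nonneg.2 (div_le_one_of_le₀ hp (by positivity))
  rw [hmean, ← Real.rpow_natCast_mul hbase, ← Finset.mul_sum, mul_comm (k : ℝ)] at hjensen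
  rw [halfTermR, zpow_neg, zpow_natCast]
  exact hjensen
end

section
/- Let f = (f_1,…,f_m) be a primitive family and k ≥ 1 an integer. Then there exists a constant C ≥ 0, depending only on k and m, such that for every real h ≥ 1, the number of k-tuples h = (h_1,…,h_k) of distinct positive integers with h_i ≤ h for all i such that the family f∘h is not primitive is at most C · h^{k−1}. -/
open Filter Topology

/-- A primitive family: a (nonempty) family of pairwise distinct polynomials in `ℤ[X]`
of degree `≥ 1`, each irreducible, with positive leading coefficient and content `1`. -/
def IsPrimitiveFamily {ι : Type*} [Fintype ι] (f : ι → Polynomial ℤ) : Prop :=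
  Nonempty ι ∧ Function.Injective f ∧
    ∀ j, Irreducible (f j) ∧ 1 ≤ (f j).natDegree ∧ 0 < (f j).leadingCoeff ∧
      (f j).content = 1

/-- The family `f∘h = (f_j(X + h_i))_{j,i}` of `m·k` polynomials. -/
noncomputable def shiftFamily {m k : ℕ} (f : Fin m → Polynomial ℤ) (h : Fin k → ℕ) :
    Fin m × Fin k → Polynomial ℤ :=
  fun ji => (f ji.1).comp (Polynomial.X + Polynomial.C (h ji.2 : ℤ))

open Polynomial in
theorem shiftFamily_apply {m k : ℕ} (f : Fin m → ℤ[X]) (h : Fin k → ℕ) (j : Fin m) (i : Fin k) :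
    shiftFamily f h (j, i) = taylor (h i : ℤ) (f j) := rfl

open Polynomial in
/-- A nonconstant integer polynomial has pairwise distinct translates. -/
theorem taylor_injective_left {p : ℤ[X]} (hp : 1 ≤ p.natDegree) :
    Function.Injective fun r : ℤ => taylor r p := by
  intro a b hab
  by_contra hne
  have hc : a - b ≠ 0 := sub_ne_zero.mpr hne
  have step (x : ℤ) : p.eval (x + (a - b)) = p.eval x := by
    have := congrArg (eval (x - b)) hab
    simp only [taylor_eval] at this
    rwa [show x - b + a = x + (a - b) by ring, sub_add_cancel] at this
  have periodic (n : ℕ) : p.eval (n * (a - b)) = p.eval 0 := by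
    induction n with
    | zero => simp
    | succ n ih => rw [← ih, ← step (n * (a - b))]; push_cast; ring_nf
  have hconst : p = C (p.eval 0) := by
    refine eq_of_infinite_eval_eq p _
      ((Set.infinite_range_of_injective (f := fun n : ℕ => (n : ℤ) * (a - b)) ?_).mono ?_)
    · intro x y hxy
      exact_mod_cast mul_right_cancel₀ hc hxy
    · rintro _ ⟨n, rfl⟩
      simp [periodic n]
  rw [hconst, natDegree_C] at hp
  omega

open Polynomial in
theorem isPrimitive_taylor {R : Type*} [CommRing R] {p : R[X]} (hp : p.IsPrimitive) (r : R) :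
    (taylor r p).IsPrimitive := by
  intro a ha
  refine hp a ?_
  have := map_dvd (taylorEquiv r).symm ha
  simpa [taylorEquiv, taylor_taylor] using this

/-- Translating a primitive family can only destroy its primitivity through a coincidence
between two translates. -/
theorem isPrimitiveFamily_shiftFamily {m k : ℕ} (hk : 1 ≤ k) {f : Fin m → Polynomial ℤ}
    (hf : IsPrimitiveFamily f) {t : Fin k → ℕ} (ht : Function.Injective (shiftFamily f t)) :
    IsPrimitiveFamily (shiftFamily f t) := by
  obtain ⟨⟨j₀⟩, -, hf⟩ := hf
  refine ⟨⟨j₀, ⟨0, hk⟩⟩, ht, ?_⟩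
  rintro ⟨j, i⟩
  obtain ⟨hirr, hdeg, hlead, hcont⟩ := hf j
  rw [shiftFamily_apply]
  refine ⟨?_, by simpa using hdeg, by simpa using hlead, ?_⟩
  · exact (MulEquiv.irreducible_iff (Polynomial.taylorEquiv (t i : ℤ))).mpr hirr
  · exact Polynomial.isPrimitive_iff_content_eq_one.mp
      (isPrimitive_taylor (Polynomial.isPrimitive_iff_content_eq_one.mpr hcont) _)

/-- Tuples in which the entry at `i` is determined by the other entries are rare. -/
theorem card_le_pow_of_eq_of_eqOn_ne {α : Type*} [DecidableEq α] {k : ℕ} (i : Fin k)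
    (s : Finset α) (B : Finset (Fin k → α)) (hB : B ⊆ Fintype.piFinset fun _ => s)
    (hdet : ∀ t ∈ B, ∀ u ∈ B, (∀ x ≠ i, t x = u x) → t i = u i) :
    B.card ≤ s.card ^ (k - 1) := by
  have hcard : (Fintype.piFinset fun _ : {x : Fin k // x ≠ i} => s).card = s.card ^ (k - 1) := by
    simp
  rw [← hcard]
  refine Finset.card_le_card_of_injOn (fun t x => t x) ?_ ?_
  · intro t ht
    simp only [Finset.mem_coe, Fintype.mem_piFinset]
    exact fun x => Fintype.mem_piFinset.mp (hB ht) x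
  · intro t ht u hu htu
    have hne : ∀ x ≠ i, t x = u x := fun x hx => congrFun htu ⟨x, hx⟩
    funext x
    by_cases hx : x = i
    · exact hx ▸ hdet t ht u hu hne
    · exact hne x hx

open Classical in
theorem card_not_isPrimitiveFamily_le {m k : ℕ} (hk : 1 ≤ k) {f : Fin m → Polynomial ℤ}
    (hf : IsPrimitiveFamily f) (N : ℕ) :
    ((distinctTuples k N).filter (fun t => ¬ IsPrimitiveFamily (shiftFamily f t))).card ≤
      (m * k) ^ 2 * N ^ (k - 1) := by
  let box : Finset (Fin k → ℕ) := Fintype.piFinset fun _ => Finset.Icc 1 N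
  let B : (Fin m × Fin k) × (Fin m × Fin k) → Finset (Fin k → ℕ) := fun q =>
    box.filter fun t => q.1.2 ≠ q.2.2 ∧ shiftFamily f t q.1 = shiftFamily f t q.2
  have hsub : (distinctTuples k N).filter (fun t => ¬ IsPrimitiveFamily (shiftFamily f t)) ⊆
      Finset.univ.biUnion B := by
    intro t ht
    obtain ⟨htN, hbad⟩ := Finset.mem_filter.mp ht
    have hinj := mt (isPrimitiveFamily_shiftFamily hk hf) hbad
    simp only [Function.Injective, not_forall] at hinj
    obtain ⟨⟨j, i⟩, ⟨j', i'⟩, heq, hne⟩ := hinj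
    refine Finset.mem_biUnion.mpr ⟨((j, i), (j', i')), Finset.mem_univ _,
      Finset.mem_filter.mpr ⟨(Finset.mem_filter.mp htN).1, ?_, heq⟩⟩
    intro hi
    obtain rfl : i = i' := hi
    exact hne (Prod.ext (hf.2.1 (Polynomial.taylor_injective _ heq)) rfl)
  have hB (q) : (B q).card ≤ N ^ (k - 1) := by
    have := card_le_pow_of_eq_of_eqOn_ne q.1.2 (Finset.Icc 1 N) (B q)
      (Finset.filter_subset _ _) ?_
    · simpa using this
    · intro t ht u hu htu
      obtain ⟨-, hne, hteq⟩ := Finset.mem_filter.mp ht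
      obtain ⟨-, -, hueq⟩ := Finset.mem_filter.mp hu
      have h₂ : shiftFamily f t q.2 = shiftFamily f u q.2 := by
        simp only [shiftFamily, htu q.2.2 hne.symm]
      exact_mod_cast taylor_injective_left (hf.2.2 q.1.1).2.1 (hteq.trans (h₂.trans hueq.symm))
  calc _ ≤ (Finset.univ.biUnion B).card := Finset.card_le_card hsub
    _ ≤ Finset.univ.card * N ^ (k - 1) := Finset.card_biUnion_le_card_mul _ _ _ fun q _ => hB q
    _ = (m * k) ^ 2 * N ^ (k - 1) := by simp [sq]

open Classical in
/-- For `k ≥ 1` and `m ≥ 1` there is a constant `C ≥ 0` (depending only on `k` and `m`)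
such that for every primitive family `f = (f_1,…,f_m)` and every real `h ≥ 1`, the
number of `k`-tuples of distinct positive integers with entries `≤ h` for which `f∘h`
is not primitive is at most `C · h^(k−1)`. -/
theorem paucity_imprimitive (k m : ℕ) (hk : 1 ≤ k) (hm : 1 ≤ m) :
    ∃ C : ℝ, 0 ≤ C ∧
      ∀ f : Fin m → Polynomial ℤ, IsPrimitiveFamily f →
        ∀ h : ℝ, 1 ≤ h →
          (((distinctTuples k ⌊h⌋₊).filter
              (fun t => ¬ IsPrimitiveFamily (shiftFamily f t))).card : ℝ) ≤
            C * h ^ ((k : ℝ) - 1) := by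
  refine ⟨((m * k) ^ 2 : ℕ), by positivity, fun f hf h hh => ?_⟩
  have hpow : h ^ ((k : ℝ) - 1) = h ^ (k - 1) := by
    rw [← Real.rpow_natCast, Nat.cast_sub hk, Nat.cast_one]
  rw [hpow]
  calc _ ≤ (((m * k) ^ 2 * ⌊h⌋₊ ^ (k - 1) : ℕ) : ℝ) :=
        Nat.cast_le.mpr (card_not_isPrimitiveFamily_le hk hf ⌊h⌋₊)
    _ = ((m * k) ^ 2 : ℕ) * (⌊h⌋₊ : ℝ) ^ (k - 1) := by push_cast; ring
    _ ≤ _ := by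
      gcongr
      exact Nat.floor_le (by linarith)
end
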